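/- arXiv:2311.17342 — 4 statements merged into one kernel-verified Lean document; each statement's English description precedes it below -/
import Mathlib

section
/- Let G be a finite connected simple graph on n vertices with maximum degree d, and let c > 1 and ε > 0 be real numbers. If S is a scramble on G with ‖S‖ ≥ ⌈c·n^(1/2+ε)⌉, then |S| ≥ exp(c·n^ε/(d+1)). -/
open SimpleGraph

universe u


/-- An egg of a graph `G`: a nonempty set of vertices inducing a connected subgraph. -/
def SimpleGraph.IsEgg {V : Type u} (G : SimpleGraph V) (A : Finset V) : Prop :=
  A.Nonempty ∧ (G.induce (A : Set V)).Connected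

/-- A scramble on `G`: a nonempty finite collection of eggs. -/
def SimpleGraph.IsScramble {V : Type u} (G : SimpleGraph V) (S : Finset (Finset V)) : Prop :=
  S.Nonempty ∧ ∀ A ∈ S, G.IsEgg A

/-- The hitting number `h(S)`: the minimum cardinality of a set of vertices meeting
every egg of `S`. -/
noncomputable def hittingNumber {V : Type u} (S : Finset (Finset V)) : ℕ :=
  sInf {n | ∃ H : Finset V, H.card = n ∧ ∀ A ∈ S, ∃ x ∈ H, x ∈ A}

/-- The number of edges of `G` with one endpoint in `A` and the other outside of `A`. -/
noncomputable def cutSize {V : Type u} (G : SimpleGraph V) (A : Set V) : ℕ :=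
  Set.ncard {e : Sym2 V | ∃ u v, e = s(u, v) ∧ G.Adj u v ∧ u ∈ A ∧ v ∉ A}

/-- An egg-cut for a scramble `S`: a vertex subset `A` containing some egg of `S` and
whose complement contains some egg of `S`. -/
def IsEggCut {V : Type u} (S : Finset (Finset V)) (A : Set V) : Prop :=
  (∃ B ∈ S, (B : Set V) ⊆ A) ∧ (∃ B ∈ S, (B : Set V) ⊆ Aᶜ)

/-- The egg-cut number `e(S)` (in `ℕ∞`): the minimum size of an egg-cut for `S`,
or `⊤` if no egg-cut exists. -/
noncomputable def eggCutNumber {V : Type u} (G : SimpleGraph V) (S : Finset (Finset V)) : ℕ∞ :=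
  sInf {n : ℕ∞ | ∃ A : Set V, IsEggCut S A ∧ n = (cutSize G A : ℕ∞)}

/-- The order `‖S‖` of a scramble: the minimum of its hitting number and
its egg-cut number. -/
noncomputable def scrambleOrder {V : Type u} (G : SimpleGraph V) (S : Finset (Finset V)) : ℕ∞ :=
  min (hittingNumber S : ℕ∞) (eggCutNumber G S)

/-- The scramble number `sn(G)`: the maximum order of a scramble on `G`. -/
noncomputable def scrambleNumber {V : Type u} (G : SimpleGraph V) : ℕ :=
  sSup {n | ∃ S : Finset (Finset V), G.IsScramble S ∧ scrambleOrder G S = (n : ℕ∞)}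

/-- A disjoint scramble: a scramble whose eggs are pairwise disjoint. -/
def IsDisjointScramble {V : Type u} (G : SimpleGraph V) (S : Finset (Finset V)) : Prop :=
  G.IsScramble S ∧ (S : Set (Finset V)).Pairwise fun A B => Disjoint (A : Set V) (B : Set V)

/-- The disjoint scramble number `dsn(G)`: the maximum order of a disjoint scramble on `G`. -/
noncomputable def disjointScrambleNumber {V : Type u} (G : SimpleGraph V) : ℕ :=
  sSup {n | ∃ S : Finset (Finset V), IsDisjointScramble G S ∧ scrambleOrder G S = (n : ℕ∞)}

/-- The carton number `cart(G)`: the minimum size (number of eggs) of a scramble on `G`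
whose order equals the scramble number of `G`. -/
noncomputable def cartonNumber {V : Type u} (G : SimpleGraph V) : ℕ :=
  sInf {n | ∃ S : Finset (Finset V), G.IsScramble S ∧
    scrambleOrder G S = (scrambleNumber G : ℕ∞) ∧ S.card = n}

/-- The maximum degree of a graph. -/
noncomputable def maxDeg {V : Type u} (G : SimpleGraph V) : ℕ :=
  sSup {n | ∃ v : V, (G.neighborSet v).ncard = n}
theorem hittingNumber_le {V : Type u} {S : Finset (Finset V)} {H : Finset V}
    (hH : ∀ A ∈ S, ∃ x ∈ H, x ∈ A) : hittingNumber S ≤ H.card :=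
  Nat.sInf_le ⟨H, rfl, hH⟩

theorem SimpleGraph.IsScramble.hittingNumber_le_card {V : Type u} {G : SimpleGraph V}
    {S : Finset (Finset V)} (hS : G.IsScramble S) : hittingNumber S ≤ S.card := by
  classical
  choose f hf using fun A : S => (hS.2 A A.2).1
  refine (hittingNumber_le (H := S.attach.image f) fun A hA =>
    ⟨f ⟨A, hA⟩, Finset.mem_image_of_mem _ (Finset.mem_attach _ _), hf ⟨A, hA⟩⟩).trans ?_
  simpa using Finset.card_image_le (s := S.attach) (f := f)

theorem SimpleGraph.IsScramble.hittingNumber_le_card_verts {V : Type u} [Fintype V]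
    {G : SimpleGraph V} {S : Finset (Finset V)} (hS : G.IsScramble S) :
    hittingNumber S ≤ Fintype.card V :=
  hittingNumber_le fun A hA => (hS.2 A hA).1.imp fun x hx => ⟨Finset.mem_univ x, hx⟩

theorem ncard_neighborSet_lt_card {V : Type u} [Fintype V] (G : SimpleGraph V) (v : V) :
    (G.neighborSet v).ncard < Fintype.card V := by
  rw [← Nat.card_eq_fintype_card, ← Set.ncard_univ]
  exact Set.ncard_lt_ncard
    ((Set.ssubset_univ_iff).2 fun h => G.irrefl (h.symm ▸ Set.mem_univ v : v ∈ G.neighborSet v))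

theorem ncard_neighborSet_le_maxDeg {V : Type u} [Fintype V] (G : SimpleGraph V) (v : V) :
    (G.neighborSet v).ncard ≤ maxDeg G :=
  le_csSup ⟨Fintype.card V, by rintro _ ⟨w, rfl⟩; exact (ncard_neighborSet_lt_card G w).le⟩
    ⟨v, rfl⟩

theorem maxDeg_lt_card {V : Type u} [Fintype V] [Nonempty V] (G : SimpleGraph V) :
    maxDeg G < Fintype.card V := by
  refine lt_of_le_of_lt (csSup_le' ?_) (Nat.sub_one_lt Fintype.card_ne_zero)
  rintro _ ⟨w, rfl⟩
  exact Nat.le_sub_one_of_lt (ncard_neighborSet_lt_card G w)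

theorem cutSize_le_card_mul_maxDeg {V : Type u} [Fintype V] (G : SimpleGraph V)
    (A : Finset V) : cutSize G A ≤ A.card * maxDeg G := by
  classical
  have hsub : {e : Sym2 V | ∃ u v, e = s(u, v) ∧ G.Adj u v ∧ u ∈ (A : Set V) ∧ v ∉ (A : Set V)} ⊆
      ⋃ u ∈ A, (fun v => s(u, v)) '' G.neighborSet u := by
    rintro _ ⟨u, v, rfl, huv, hu, -⟩
    exact Set.mem_biUnion hu ⟨v, huv, rfl⟩
  calc cutSize G A ≤ (⋃ u ∈ A, (fun v => s(u, v)) '' G.neighborSet u).ncard :=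
        Set.ncard_le_ncard hsub (Set.toFinite _)
    _ ≤ ∑ u ∈ A, ((fun v => s(u, v)) '' G.neighborSet u).ncard :=
        Finset.set_ncard_biUnion_le _ _
    _ ≤ ∑ _u ∈ A, maxDeg G := Finset.sum_le_sum fun u _ =>
        (Set.ncard_image_le (Set.toFinite _)).trans (ncard_neighborSet_le_maxDeg G u)
    _ = A.card * maxDeg G := by simp

/-- In a scramble of order at least `k`, every egg `A` satisfies `k ≤ |A| * maxDeg G`: otherwise
either `A` is a small hitting set or `A` defines a small egg-cut. -/
theorem le_card_mul_maxDeg_of_le_scrambleOrder {V : Type u} [Fintype V] {G : SimpleGraph V}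
    {S : Finset (Finset V)} {k : ℕ} (hd : 1 ≤ maxDeg G) (hk : (k : ℕ∞) ≤ scrambleOrder G S)
    {A : Finset V} (hA : A ∈ S) : k ≤ A.card * maxDeg G := by
  by_cases h : ∃ B ∈ S, Disjoint A B
  · obtain ⟨B, hB, hAB⟩ := h
    have hcut : eggCutNumber G S ≤ (cutSize G A : ℕ∞) :=
      sInf_le ⟨A, ⟨⟨A, hA, subset_rfl⟩, B, hB,
        (Finset.disjoint_coe.2 hAB).symm.subset_compl_right⟩, rfl⟩
    have : (k : ℕ∞) ≤ (cutSize G A : ℕ∞) := (hk.trans (min_le_right _ _)).trans hcut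
    exact (Nat.cast_le.1 this).trans (cutSize_le_card_mul_maxDeg G A)
  · have hk' : k ≤ hittingNumber S := Nat.cast_le.1 (hk.trans (min_le_left _ _))
    refine (hk'.trans (hittingNumber_le fun B hB => ?_)).trans (Nat.le_mul_of_pos_right _ hd)
    exact Finset.not_disjoint_iff.1 fun hAB => h ⟨B, hB, hAB⟩

/-- A family of large sets has an element lying in an at least average share of its members. -/
theorem exists_mul_card_le_card_filter_mem {V : Type u} [Fintype V] [Nonempty V] [DecidableEq V]
    {T : Finset (Finset V)} {a : ℝ} (ha : ∀ A ∈ T, a ≤ A.card) :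
    ∃ v : V, a / Fintype.card V * T.card ≤ (T.filter fun A => v ∈ A).card := by
  have hn : (0 : ℝ) < Fintype.card V := by exact_mod_cast Fintype.card_pos
  have hdouble : ∑ v : V, ((T.filter fun A => v ∈ A).card : ℝ) = ∑ A ∈ T, (A.card : ℝ) := by
    have := Finset.sum_card_bipartiteAbove_eq_sum_card_bipartiteBelow
      (s := (Finset.univ : Finset V)) (t := T) (fun v A => v ∈ A)
    simp only [Finset.bipartiteAbove, Finset.bipartiteBelow, Finset.filter_univ_mem] at this
    exact_mod_cast this
  obtain ⟨v, -, hv⟩ := Finset.exists_le_of_sum_le (s := (Finset.univ : Finset V))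
    (f := fun _ => a / Fintype.card V * T.card)
    (g := fun v => ((T.filter fun A => v ∈ A).card : ℝ)) Finset.univ_nonempty (by
      rw [hdouble]
      calc ∑ _v : V, a / Fintype.card V * T.card = ∑ _A ∈ T, a := by
            simp only [Finset.sum_const, Finset.card_univ, nsmul_eq_mul]; field_simp
        _ ≤ _ := Finset.sum_le_sum ha)
  exact ⟨v, hv⟩

/-- Greedy hitting: if all members of `S` have size at least `a`, then some `m` elements miss at
most a proportion `exp (-a m / n)` of the members. -/
theorem exists_card_le_card_filter_disjoint_le {V : Type u} [Fintype V] [Nonempty V]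
    [DecidableEq V] {S : Finset (Finset V)} {a : ℝ} (ha : ∀ A ∈ S, a ≤ A.card) (m : ℕ) :
    ∃ H : Finset V, H.card ≤ m ∧
      ((S.filter fun A => Disjoint H A).card : ℝ) ≤
        S.card * Real.exp (-(a * m / Fintype.card V)) := by
  induction m with
  | zero => exact ⟨∅, by simp⟩
  | succ m ih =>
    obtain ⟨H, hHm, hH⟩ := ih
    set T := S.filter fun A => Disjoint H A with hT
    obtain ⟨v, hv⟩ := exists_mul_card_le_card_filter_mem (T := T)
      fun A hA => ha A (Finset.mem_filter.1 hA).1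
    refine ⟨insert v H, (Finset.card_insert_le _ _).trans (by omega), ?_⟩
    have hfilter : (S.filter fun A => Disjoint (insert v H) A) = T.filter fun A => v ∉ A := by
      rw [hT, Finset.filter_filter]
      exact Finset.filter_congr fun A _ => by rw [Finset.disjoint_insert_left, and_comm]
    have hsplit : ((T.filter fun A => v ∈ A).card : ℝ) + (T.filter fun A => v ∉ A).card = T.card := by
      exact_mod_cast Finset.card_filter_add_card_filter_not (s := T) (fun A => v ∈ A)
    have hexp : 1 - a / Fintype.card V ≤ Real.exp (-(a / Fintype.card V)) := by
      linarith [Real.add_one_le_exp (-(a / Fintype.card V : ℝ))]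
    calc ((S.filter fun A => Disjoint (insert v H) A).card : ℝ)
        ≤ T.card * (1 - a / Fintype.card V) := by rw [hfilter]; linarith
      _ ≤ T.card * Real.exp (-(a / Fintype.card V)) := by gcongr
      _ ≤ S.card * Real.exp (-(a * m / Fintype.card V)) * Real.exp (-(a / Fintype.card V)) := by
          gcongr
      _ = S.card * Real.exp (-(a * (m + 1 : ℕ) / Fintype.card V)) := by
          rw [mul_assoc, ← Real.exp_add]; push_cast; ring_nf

theorem exp_le_card_of_lt_hittingNumber {V : Type u} [Fintype V] [Nonempty V]
    {S : Finset (Finset V)} {a : ℝ} (ha : ∀ A ∈ S, a ≤ A.card) {m : ℕ}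
    (hm : m < hittingNumber S) : Real.exp (a * m / Fintype.card V) ≤ S.card := by
  classical
  by_contra! hlt
  obtain ⟨H, hHm, hH⟩ := exists_card_le_card_filter_disjoint_le ha m
  have hone : (S.card : ℝ) * Real.exp (-(a * m / Fintype.card V)) < 1 := by
    rwa [Real.exp_neg, ← div_eq_mul_inv, div_lt_one (Real.exp_pos _)]
  have hzero : (S.filter fun A => Disjoint H A).card = 0 :=
    Nat.lt_one_iff.1 (by exact_mod_cast hH.trans_lt hone)
  refine (hittingNumber_le (H := H) fun A hA => Finset.not_disjoint_iff.1 fun hdisj => ?_).not_gt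
    (hHm.trans_lt hm)
  exact Finset.filter_eq_empty_iff.1 (Finset.card_eq_zero.1 hzero) hA hdisj

/-- If `G` is a finite connected simple graph on `n` vertices with
maximum degree `d`, `c > 1`, `ε > 0`, and `S` is a scramble on `G` with
`‖S‖ ≥ ⌈c·n^(1/2+ε)⌉`, then `|S| ≥ exp(c·n^ε/(d+1))`. -/
theorem size_ge_exp_of_large_order {V : Type u} [Fintype V] (G : SimpleGraph V)
    (hconn : G.Connected) (d : ℕ) (hd : maxDeg G = d) (c ε : ℝ) (hc : 1 < c) (hε : 0 < ε)
    (S : Finset (Finset V)) (hS : G.IsScramble S)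
    (horder : (⌈c * (Fintype.card V : ℝ) ^ ((1 : ℝ) / 2 + ε)⌉₊ : ℕ∞) ≤ scrambleOrder G S) :
    Real.exp (c * (Fintype.card V : ℝ) ^ ε / (d + 1)) ≤ (S.card : ℝ) := by
  have := hconn.nonempty
  set n := Fintype.card V with hn
  set k := ⌈c * (n : ℝ) ^ ((1 : ℝ) / 2 + ε)⌉₊ with hk
  subst hd
  have hn0 : 1 ≤ n := Fintype.card_pos
  have hn0' : (1 : ℝ) ≤ n := by exact_mod_cast hn0
  have hkh : k ≤ hittingNumber S := Nat.cast_le.1 (horder.trans (min_le_left _ _))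
  have hkn : k ≤ n := hkh.trans hS.hittingNumber_le_card_verts
  have hkS : k ≤ S.card := hkh.trans hS.hittingNumber_le_card
  set y := c * (n : ℝ) ^ ε with hy
  have hpow : 1 ≤ (n : ℝ) ^ ε := Real.one_le_rpow hn0' hε.le
  have hy1 : 1 < y := by nlinarith
  set s := √(n : ℝ) with hs
  have hs1 : 1 ≤ s := Real.one_le_sqrt.2 hn0'
  have hss : s * s = n := Real.mul_self_sqrt (by positivity)
  have hsk : y * s ≤ k := by
    refine le_trans (le_of_eq ?_) (Nat.le_ceil _)
    rw [Real.rpow_add (by positivity), ← Real.sqrt_eq_rpow]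
    ring
  have hslt : s < k := by nlinarith
  have hk2 : 2 ≤ k := by
    have : (1 : ℝ) < k := hs1.trans_lt hslt
    exact_mod_cast this
  have : Nontrivial V := Fintype.one_lt_card_iff_nontrivial.1 (by omega)
  have hd1 : 1 ≤ maxDeg G := by
    obtain ⟨v, w, hvw⟩ := exists_pair_ne V
    obtain ⟨u, hu⟩ := hconn.preconnected.exists_adj_of_nontrivial v
    exact ((Set.ncard_pos (Set.toFinite _)).2 ⟨u, hu⟩).trans_le (ncard_neighborSet_le_maxDeg G v)
  have hegg {A : Finset V} (hA : A ∈ S) : k ≤ A.card * maxDeg G :=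
    le_card_mul_maxDeg_of_le_scrambleOrder hd1 horder hA
  have hdlt : maxDeg G < n := maxDeg_lt_card G
  set d := maxDeg G
  have hd1' : (1 : ℝ) ≤ d := by exact_mod_cast hd1
  rcases le_or_gt ((d : ℝ) + 1) s with hds | hds
  · have ha : ∀ A ∈ S, (k / d : ℝ) ≤ A.card := fun A hA =>
      (div_le_iff₀ (by positivity)).2 (by exact_mod_cast hegg hA)
    refine le_trans (Real.exp_le_exp.2 ?_)
      (exp_le_card_of_lt_hittingNumber ha (m := k - 1) (by omega))
    have hdk : s * d ≤ (k - 1) * (d + 1) := by nlinarith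
    rw [← hn, Nat.cast_pred (by omega), div_mul_eq_mul_div, div_div,
      div_le_div_iff₀ (by positivity) (by positivity), ← hss]
    calc y * (d * (s * s)) = y * s * (s * d) := by ring
      _ ≤ k * ((k - 1) * (d + 1)) := by gcongr
      _ = k * (k - 1) * (d + 1) := by ring
  · have hyd : y / (d + 1) ≤ k / n := by
      rw [div_le_div_iff₀ (by positivity) (by positivity), ← hss]
      nlinarith [mul_le_mul hsk hds.le (by positivity) (by positivity)]
    refine (Real.exp_le_exp.2 hyd).trans ?_
    rcases hk2.lt_or_eq with hk3 | hk2
    · have hkn1 : (k / n : ℝ) ≤ 1 := (div_le_one (by positivity)).2 (by exact_mod_cast hkn)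
      have hS3 : (3 : ℝ) ≤ S.card := by exact_mod_cast hk3.trans_le hkS
      linarith [Real.exp_le_exp.2 hkn1, Real.exp_one_lt_d9]
    · have hn4 : n < 4 := by
        by_contra! h4
        have h4' : (4 : ℝ) ≤ n := by exact_mod_cast h4
        rw [← hk2] at hslt
        push_cast at hslt
        nlinarith
      have hn3 : n = 3 := by
        by_contra hne
        have hn2 : n = 2 := by omega
        have hle : hittingNumber S ≤ 1 := by
          obtain ⟨v⟩ := hconn.nonempty
          refine hittingNumber_le (H := {v}) fun A hA => ⟨v, Finset.mem_singleton_self v, ?_⟩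
          have hd : d = 1 := by omega
          have hA2 := hegg hA
          rw [hd, mul_one] at hA2
          have : A = Finset.univ := (Finset.card_eq_iff_eq_univ A).1
            (le_antisymm (Finset.card_le_univ A) (by omega))
          exact this ▸ Finset.mem_univ v
        omega
      have hS2 : (2 : ℝ) ≤ S.card := by exact_mod_cast hk2.le.trans hkS
      refine le_trans ?_ hS2
      rw [← hk2, hn3]
      have hcube : Real.exp ((2 : ℕ) / (3 : ℕ) : ℝ) ^ 3 = Real.exp 1 ^ 2 := by
        rw [← Real.exp_nat_mul, ← Real.exp_nat_mul]; norm_num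
      refine le_of_pow_le_pow_left₀ (n := 3) (by norm_num) (by norm_num) ?_
      rw [hcube]
      nlinarith [Real.exp_one_lt_d9, Real.exp_pos 1]
end

section
/- Let G be a finite connected simple graph and S a scramble on G. Then there exists a nonempty subcollection S' ⊆ S (a subset scramble) such that ‖S'‖ = ‖S‖ and h(S') = ‖S'‖. -/
open SimpleGraph

universe u


theorem exists_card_eq_hittingNumber {V : Type u} {S : Finset (Finset V)}
    (hS : ∀ A ∈ S, A.Nonempty) :
    ∃ H : Finset V, H.card = hittingNumber S ∧ ∀ A ∈ S, ∃ x ∈ H, x ∈ A := by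
  classical
  refine Nat.sInf_mem (s := {n | ∃ H : Finset V, H.card = n ∧ ∀ A ∈ S, ∃ x ∈ H, x ∈ A})
    ⟨_, S.biUnion id, rfl, fun A hA => ?_⟩
  obtain ⟨x, hx⟩ := hS A hA
  exact ⟨x, Finset.mem_biUnion.2 ⟨A, hA, hx⟩, hx⟩

theorem hittingNumber_empty {V : Type u} : hittingNumber (∅ : Finset (Finset V)) = 0 :=
  Nat.le_zero.1 (hittingNumber_le (H := ∅) (by simp))

theorem hittingNumber_pos {V : Type u} {S : Finset (Finset V)} (hne : S.Nonempty)
    (hS : ∀ A ∈ S, A.Nonempty) : 0 < hittingNumber S := by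
  obtain ⟨H, hcard, hH⟩ := exists_card_eq_hittingNumber hS
  obtain ⟨A, hA⟩ := hne
  obtain ⟨x, hx, -⟩ := hH A hA
  exact hcard ▸ Finset.card_pos.2 ⟨x, hx⟩

theorem hittingNumber_insert_le {V : Type u} [DecidableEq V] {S : Finset (Finset V)}
    {A : Finset V} (hA : A.Nonempty) (hS : ∀ B ∈ S, B.Nonempty) :
    hittingNumber (insert A S) ≤ hittingNumber S + 1 := by
  obtain ⟨H, hcard, hH⟩ := exists_card_eq_hittingNumber hS
  obtain ⟨x, hx⟩ := hA
  refine (hittingNumber_le (H := insert x H) fun B hB => ?_).trans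
    (hcard ▸ Finset.card_insert_le x H)
  rcases Finset.mem_insert.1 hB with rfl | hB
  · exact ⟨x, Finset.mem_insert_self x H, hx⟩
  · obtain ⟨y, hy, hyB⟩ := hH B hB
    exact ⟨y, Finset.mem_insert_of_mem hy, hyB⟩

/-- Every value up to `h(S)` is the hitting number of a subcollection of `S`. -/
theorem exists_subset_hittingNumber_eq {V : Type u} (S : Finset (Finset V))
    (hS : ∀ A ∈ S, A.Nonempty) {k : ℕ} (hk : k ≤ hittingNumber S) :
    ∃ S' ⊆ S, hittingNumber S' = k := by
  classical
  induction S using Finset.induction_on with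
  | empty => exact ⟨∅, subset_rfl, by rw [hittingNumber_empty] at hk ⊢; omega⟩
  | insert A S _ ih =>
    have hS' : ∀ B ∈ S, B.Nonempty := fun B hB => hS B (Finset.mem_insert_of_mem hB)
    have hle := hittingNumber_insert_le (hS A (Finset.mem_insert_self A S)) hS'
    rcases hk.eq_or_lt with rfl | hlt
    · exact ⟨_, subset_rfl, rfl⟩
    · obtain ⟨S', hsub, h⟩ := ih hS' (by omega)
      exact ⟨S', hsub.trans (Finset.subset_insert A S), h⟩

theorem IsEggCut.mono {V : Type u} {S S' : Finset (Finset V)} {A : Set V} (h : S' ⊆ S)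
    (hA : IsEggCut S' A) : IsEggCut S A := by
  obtain ⟨⟨B, hB, hBA⟩, C, hC, hCA⟩ := hA
  exact ⟨⟨B, h hB, hBA⟩, C, h hC, hCA⟩

theorem eggCutNumber_anti {V : Type u} (G : SimpleGraph V) {S S' : Finset (Finset V)}
    (h : S' ⊆ S) : eggCutNumber G S ≤ eggCutNumber G S' :=
  sInf_le_sInf fun _ ⟨A, hA, hn⟩ => ⟨A, hA.mono h, hn⟩

theorem cutSize_pos {V : Type u} [Finite V] {G : SimpleGraph V} (hconn : G.Connected)
    {A : Set V} (hA : A.Nonempty) (hAc : Aᶜ.Nonempty) : 0 < cutSize G A := by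
  obtain ⟨u, hu⟩ := hA
  obtain ⟨v, hv⟩ := hAc
  obtain ⟨p⟩ := hconn.preconnected u v
  obtain ⟨d, -, hd, hd'⟩ := p.exists_boundary_dart A hu hv
  exact (Set.ncard_pos (Set.toFinite _)).2 ⟨_, d.fst, d.snd, rfl, d.adj, hd, hd'⟩

theorem one_le_eggCutNumber {V : Type u} [Finite V] {G : SimpleGraph V} (hconn : G.Connected)
    {S : Finset (Finset V)} (hS : ∀ A ∈ S, A.Nonempty) : 1 ≤ eggCutNumber G S := by
  refine le_sInf ?_
  rintro _ ⟨A, ⟨⟨B, hB, hBA⟩, C, hC, hCA⟩, rfl⟩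
  exact_mod_cast cutSize_pos hconn ((Finset.coe_nonempty.2 (hS B hB)).mono hBA)
    ((Finset.coe_nonempty.2 (hS C hC)).mono hCA)

/-- Every scramble `S` on a finite connected simple graph `G` has a
nonempty subcollection `S' ⊆ S` with `‖S'‖ = ‖S‖` and `h(S') = ‖S'‖`. -/
theorem exists_subset_scramble_order_eq_hitting {V : Type u} [Fintype V]
    (G : SimpleGraph V) (hconn : G.Connected) (S : Finset (Finset V))
    (hS : G.IsScramble S) :
    ∃ S' : Finset (Finset V), S' ⊆ S ∧ S'.Nonempty ∧
      scrambleOrder G S' = scrambleOrder G S ∧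
      (hittingNumber S' : ℕ∞) = scrambleOrder G S' := by
  have hne : ∀ A ∈ S, A.Nonempty := fun A hA => (hS.2 A hA).1
  have hle : scrambleOrder G S ≤ (hittingNumber S : ℕ∞) := min_le_left _ _
  have hpos : 1 ≤ scrambleOrder G S :=
    le_min (by exact_mod_cast hittingNumber_pos hS.1 hne) (one_le_eggCutNumber hconn hne)
  obtain ⟨k, hk⟩ := ENat.ne_top_iff_exists.1 (ne_top_of_le_ne_top (ENat.natCast_ne_top _) hle)
  rw [← hk] at hle hpos
  obtain ⟨S', hsub, hS'⟩ := exists_subset_hittingNumber_eq S hne (by exact_mod_cast hle)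
  have horder : scrambleOrder G S' = k := by
    rw [scrambleOrder, hS']
    exact min_eq_left (hk.le.trans ((min_le_right _ _).trans (eggCutNumber_anti G hsub)))
  refine ⟨S', hsub, ?_, horder.trans hk, by rw [horder, hS']⟩
  rw [Finset.nonempty_iff_ne_empty]
  rintro rfl
  rw [← hS', hittingNumber_empty] at hpos
  simp at hpos
end

section
/- Let G be a finite connected simple graph on n vertices and S a scramble on G of maximum order, i.e. ‖S‖ = sn(G). Then there exists a nonempty subcollection S' ⊆ S with ‖S'‖ = sn(G) and |S'| ≤ C(n, ⌊n/2⌋) (the central binomial coefficient). -/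
open SimpleGraph

universe u


/-- The inclusion-minimal members of a family of finite sets. -/
noncomputable def minimalEggs {V : Type u} (S : Finset (Finset V)) : Finset (Finset V) := by
  classical exact S.filter fun A => Minimal (· ∈ S) A

theorem mem_minimalEggs {V : Type u} {S : Finset (Finset V)} {A : Finset V} :
    A ∈ minimalEggs S ↔ Minimal (· ∈ S) A := by
  simp only [minimalEggs, Finset.mem_filter, and_iff_right_iff_imp]
  exact fun h => h.prop

theorem minimalEggs_subset {V : Type u} (S : Finset (Finset V)) : minimalEggs S ⊆ S :=
  fun _ hA => (mem_minimalEggs.1 hA).prop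

theorem exists_mem_minimalEggs_subset {V : Type u} {S : Finset (Finset V)} {A : Finset V}
    (hA : A ∈ S) : ∃ B ∈ minimalEggs S, B ⊆ A := by
  obtain ⟨B, hBA, hB⟩ := S.exists_le_minimal hA
  exact ⟨B, mem_minimalEggs.2 hB, hBA⟩

theorem isAntichain_minimalEggs {V : Type u} (S : Finset (Finset V)) :
    IsAntichain (· ⊆ ·) (minimalEggs S : Set (Finset V)) := fun _ hA _ hB hne hAB =>
  hne <| (mem_minimalEggs.1 hB).eq_of_le (minimalEggs_subset S hA) hAB

theorem hittingNumber_minimalEggs {V : Type u} (S : Finset (Finset V)) :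
    hittingNumber (minimalEggs S) = hittingNumber S := by
  unfold hittingNumber
  congr 1
  ext n
  refine exists_congr fun H => and_congr_right fun _ =>
    ⟨fun h A hA => ?_, fun h A hA => h A (minimalEggs_subset S hA)⟩
  obtain ⟨B, hB, hBA⟩ := exists_mem_minimalEggs_subset hA
  obtain ⟨x, hx, hxB⟩ := h B hB
  exact ⟨x, hx, hBA hxB⟩

theorem exists_mem_minimalEggs_subset_iff {V : Type u} {S : Finset (Finset V)} {A : Set V} :
    (∃ B ∈ minimalEggs S, (B : Set V) ⊆ A) ↔ ∃ B ∈ S, (B : Set V) ⊆ A := by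
  refine ⟨fun ⟨B, hB, hBA⟩ => ⟨B, minimalEggs_subset S hB, hBA⟩, fun ⟨B, hB, hBA⟩ => ?_⟩
  obtain ⟨C, hC, hCB⟩ := exists_mem_minimalEggs_subset hB
  exact ⟨C, hC, (Finset.coe_subset.2 hCB).trans hBA⟩

theorem isEggCut_minimalEggs {V : Type u} {S : Finset (Finset V)} {A : Set V} :
    IsEggCut (minimalEggs S) A ↔ IsEggCut S A :=
  and_congr exists_mem_minimalEggs_subset_iff exists_mem_minimalEggs_subset_iff

theorem scrambleOrder_minimalEggs {V : Type u} (G : SimpleGraph V) (S : Finset (Finset V)) :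
    scrambleOrder G (minimalEggs S) = scrambleOrder G S := by
  simp only [scrambleOrder, eggCutNumber, hittingNumber_minimalEggs, isEggCut_minimalEggs]

/-- Every maximum order scramble `S` on a finite connected simple graph
`G` on `n` vertices has a nonempty subcollection `S' ⊆ S` of maximum order with
`|S'| ≤ C(n, ⌊n/2⌋)`. -/
theorem exists_subset_scramble_card_le_central_binom {V : Type u} [Fintype V]
    (G : SimpleGraph V) (hconn : G.Connected) (S : Finset (Finset V))
    (hS : G.IsScramble S) (hmax : scrambleOrder G S = (scrambleNumber G : ℕ∞)) :
    ∃ S' : Finset (Finset V), S' ⊆ S ∧ S'.Nonempty ∧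
      scrambleOrder G S' = (scrambleNumber G : ℕ∞) ∧
      S'.card ≤ (Fintype.card V).choose (Fintype.card V / 2) := by
  obtain ⟨A, hA⟩ := hS.1
  obtain ⟨B, hB, -⟩ := exists_mem_minimalEggs_subset hA
  exact ⟨minimalEggs S, minimalEggs_subset S, ⟨B, hB⟩,
    (scrambleOrder_minimalEggs G S).trans hmax, (isAntichain_minimalEggs S).sperner⟩
end

section
/- Let G be a finite connected simple graph with |V(G)| ≥ 3. Then scw(G) ≤ vcon(G). -/
open SimpleGraph

universe u


/-- A tree-cut decomposition of `G`: a finite tree `T` together with an assignment of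
each vertex of `G` to a node of `T` (the bags `loc ⁻¹' {b}` form a near-partition
of the vertices). -/
structure TreeCutDecomp {V : Type u} (G : SimpleGraph V) where
  β : Type
  fintypeβ : Fintype β
  T : SimpleGraph β
  isTree : T.IsTree
  loc : V → β

/-- The adhesion of a link (edge `ab` of `T`): the set of edges `uv` of `G` whose
endpoints are assigned to nodes lying in different components of `T` minus the link. -/
def TreeCutDecomp.linkAdh {V : Type u} {G : SimpleGraph V} (D : TreeCutDecomp G)
    (a b : D.β) : Set (Sym2 V) :=
  {e | ∃ u v : V, e = s(u, v) ∧ G.Adj u v ∧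
    ¬ (D.T.deleteEdges {s(a, b)}).Reachable (D.loc u) (D.loc v)}

/-- The adhesion of a node `b` of `T`: the set of edges `uv` of `G` whose endpoints
are assigned to nodes lying in different components of `T` minus the node `b`. -/
def TreeCutDecomp.nodeAdh {V : Type u} {G : SimpleGraph V} (D : TreeCutDecomp G)
    (b : D.β) : Set (Sym2 V) :=
  {e | ∃ u v : V, e = s(u, v) ∧ G.Adj u v ∧
    ∃ (hu : D.loc u ≠ b) (hv : D.loc v ≠ b),
      ¬ (D.T.induce {x | x ≠ b}).Reachable ⟨D.loc u, hu⟩ ⟨D.loc v, hv⟩}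

/-- The width of a tree-cut decomposition: the maximum over all links of the adhesion
size, and over all nodes of the bag size plus the adhesion size. -/
noncomputable def TreeCutDecomp.width {V : Type u} {G : SimpleGraph V}
    (D : TreeCutDecomp G) : ℕ :=
  sSup ({n | ∃ a b : D.β, D.T.Adj a b ∧ (D.linkAdh a b).ncard = n} ∪
        {n | ∃ b : D.β, (D.loc ⁻¹' {b}).ncard + (D.nodeAdh b).ncard = n})

/-- The screewidth of `G`: the minimum width of a tree-cut decomposition of `G`. -/
noncomputable def screewidth {V : Type u} (G : SimpleGraph V) : ℕ :=
  sInf {n | ∃ D : TreeCutDecomp G, D.width = n}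

/-- An embedding of `G` into a subcubic tree: an injection of the vertices of `G` into
the leaves of a finite tree all of whose nodes have degree at most `3`. -/
structure SubcubicTreeEmbedding {V : Type u} (G : SimpleGraph V) where
  β : Type
  fintypeβ : Fintype β
  T : SimpleGraph β
  isTree : T.IsTree
  subcubic : ∀ x : β, (T.neighborSet x).ncard ≤ 3
  emb : V ↪ β
  emb_leaf : ∀ v : V, (T.neighborSet (emb v)).ncard = 1

/-- The congestion of an embedding: the maximum over nodes `x` of the tree of the number
of edges `vw` of `G` whose associated path in the tree passes through `x` (a node lies on
the unique path between two nodes of a tree iff it lies on every walk between them). -/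
noncomputable def SubcubicTreeEmbedding.congestion {V : Type u} {G : SimpleGraph V}
    (E : SubcubicTreeEmbedding G) : ℕ :=
  sSup {n | ∃ x : E.β, Set.ncard {e : Sym2 V | ∃ v w : V, e = s(v, w) ∧ G.Adj v w ∧
    ∀ p : E.T.Walk (E.emb v) (E.emb w), x ∈ p.support} = n}

/-- The vertex congestion of `G`: the minimum congestion over all embeddings of `G`
into subcubic trees. -/
noncomputable def vertexCongestion {V : Type u} (G : SimpleGraph V) : ℕ :=
  sInf {n | ∃ E : SubcubicTreeEmbedding G, E.congestion = n}

/-- The parent of a node in the caterpillar on `Fin (2 * n)`: an odd node hangs off the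
even node preceding it, and the even nodes form the spine. -/
def caterpillarParent {n : ℕ} (x : Fin (2 * n)) : Fin (2 * n) :=
  ⟨if x.val % 2 = 1 then x.val - 1 else x.val - 2, by have := x.isLt; split <;> omega⟩

/-- The caterpillar with `n` spine nodes, each carrying one pendant node. -/
def caterpillar (n : ℕ) : SimpleGraph (Fin (2 * n)) :=
  SimpleGraph.fromRel fun x y => caterpillarParent x = y

lemma caterpillar_adj_iff {n : ℕ} (x y : Fin (2 * n)) :
    (caterpillar n).Adj x y ↔ x ≠ y ∧ (caterpillarParent x = y ∨ caterpillarParent y = x) := by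
  simp [caterpillar]

lemma caterpillar_connected {n : ℕ} (hn : 0 < n) : (caterpillar n).Connected := by
  have root : ∀ k (hk : k < 2 * n),
      (caterpillar n).Reachable ⟨k, hk⟩ ⟨0, by omega⟩ := by
    intro k
    induction k using Nat.strong_induction_on with
    | _ k ih =>
      intro hk
      rcases Nat.eq_zero_or_pos k with rfl | hpos
      · exact Reachable.refl _
      have hlt : (caterpillarParent ⟨k, hk⟩ : Fin (2 * n)).val < k := by
        simp only [caterpillarParent]
        split <;> omega
      refine Reachable.trans (Adj.reachable ?_) (ih _ hlt (Fin.isLt _))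
      rw [caterpillar_adj_iff]
      exact ⟨fun h => hlt.ne (congrArg Fin.val h).symm, Or.inl rfl⟩
  have : Nonempty (Fin (2 * n)) := ⟨⟨0, by omega⟩⟩
  exact ⟨fun x y => (root x x.isLt).trans (root y y.isLt).symm⟩

lemma caterpillar_isTree {n : ℕ} (hn : 0 < n) : (caterpillar n).IsTree := by
  refine isTree_iff_connected_and_card.2 ⟨caterpillar_connected hn, ?_⟩
  refine le_antisymm ?_ (caterpillar_connected hn).card_vert_le_card_edgeSet_add_one
  have hsub : (caterpillar n).edgeSet ⊆
      (fun x => s(x, caterpillarParent x)) '' ({⟨0, by omega⟩}ᶜ : Set (Fin (2 * n))) := by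
    have nonroot : ∀ x : Fin (2 * n), x ≠ caterpillarParent x → x ≠ ⟨0, by omega⟩ := by
      rintro x hx rfl
      simp [caterpillarParent] at hx
    intro e
    induction e with
    | _ x y =>
      rw [mem_edgeSet, caterpillar_adj_iff]
      rintro ⟨hne, rfl | rfl⟩
      · exact ⟨x, nonroot x hne, rfl⟩
      · exact ⟨y, nonroot y hne.symm, Sym2.eq_swap⟩
  have hcard := (Set.ncard_le_ncard hsub).trans (Set.ncard_image_le (Set.toFinite _))
  rw [Set.ncard_compl, Set.ncard_singleton, Nat.card_eq_fintype_card, Fintype.card_fin] at hcard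
  rw [Nat.card_coe_set_eq, Nat.card_eq_fintype_card, Fintype.card_fin]
  omega

lemma caterpillar_ncard_neighborSet_le {n : ℕ} (x : Fin (2 * n)) :
    ((caterpillar n).neighborSet x).ncard ≤ 3 := by
  have hsub : Fin.val '' (caterpillar n).neighborSet x ⊆
      ({(caterpillarParent x).val, x.val + 1, x.val + 2} : Finset ℕ) := by
    rintro _ ⟨y, hy, rfl⟩
    rw [mem_neighborSet, caterpillar_adj_iff] at hy
    obtain ⟨hne, h | h⟩ := hy
    · simp [h]
    · have hval := congrArg Fin.val h
      have hne' := Fin.val_ne_of_ne hne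
      simp only [caterpillarParent] at hval
      simp only [Finset.coe_insert, Finset.coe_singleton, Set.mem_insert_iff,
        Set.mem_singleton_iff]
      split at hval <;> omega
  rw [← Set.ncard_image_of_injective _ Fin.val_injective]
  refine (Set.ncard_le_ncard hsub (Finset.finite_toSet _)).trans ?_
  rw [Set.ncard_coe_finset]
  exact Finset.card_le_three

lemma caterpillar_ncard_neighborSet_of_odd {n : ℕ} (x : Fin (2 * n)) (hx : x.val % 2 = 1) :
    ((caterpillar n).neighborSet x).ncard = 1 := by
  refine Set.ncard_eq_one.2 ⟨caterpillarParent x, ?_⟩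
  ext y
  rw [mem_neighborSet, caterpillar_adj_iff, Set.mem_singleton_iff]
  simp only [ne_eq, Fin.ext_iff, caterpillarParent]
  split <;> split <;> omega

/-- Every finite nonempty graph embeds into the leaves of a subcubic tree. -/
lemma nonempty_subcubicTreeEmbedding {V : Type u} [Fintype V] [Nonempty V] (G : SimpleGraph V) :
    Nonempty (SubcubicTreeEmbedding G) :=
  ⟨{ β := Fin (2 * Fintype.card V)
     fintypeβ := inferInstance
     T := caterpillar (Fintype.card V)
     isTree := caterpillar_isTree Fintype.card_pos
     subcubic := caterpillar_ncard_neighborSet_le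
     emb := (Fintype.equivFin V).toEmbedding.trans
       ⟨fun i => ⟨2 * i.val + 1, by omega⟩, fun i j h => by
         simp only [Fin.mk.injEq] at h
         omega⟩
     emb_leaf := fun v => caterpillar_ncard_neighborSet_of_odd _ (Nat.mul_add_mod 2 _ 1) }⟩

namespace SubcubicTreeEmbedding

variable {V : Type u} {G : SimpleGraph V} (E : SubcubicTreeEmbedding G)

/-- The edges of `G` whose path in the tree passes through the node `x`. -/
def edgesThrough (x : E.β) : Set (Sym2 V) :=
  {e | ∃ v w : V, e = s(v, w) ∧ G.Adj v w ∧
    ∀ p : E.T.Walk (E.emb v) (E.emb w), x ∈ p.support}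

lemma ncard_edgesThrough_le_congestion (x : E.β) :
    (E.edgesThrough x).ncard ≤ E.congestion := by
  have := E.fintypeβ
  exact le_csSup (Set.finite_range fun y => (E.edgesThrough y).ncard).bddAbove ⟨x, rfl⟩

/-- An embedding into a subcubic tree, regarded as a tree-cut decomposition. -/
def toTreeCutDecomp : TreeCutDecomp G where
  β := E.β
  fintypeβ := E.fintypeβ
  T := E.T
  isTree := E.isTree
  loc := E.emb

lemma linkAdh_subset_edgesThrough (a b : E.β) :
    E.toTreeCutDecomp.linkAdh a b ⊆ E.edgesThrough a := by
  rintro e ⟨u, v, rfl, huv, hsep⟩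
  refine ⟨u, v, rfl, huv, fun p => ?_⟩
  by_contra ha
  exact hsep ⟨p.toDeleteEdge _ fun he => ha (p.fst_mem_support_of_mem_edges he)⟩

lemma nodeAdh_subset_edgesThrough (b : E.β) :
    E.toTreeCutDecomp.nodeAdh b ⊆ E.edgesThrough b := by
  rintro e ⟨u, v, rfl, huv, hu, hv, hsep⟩
  refine ⟨u, v, rfl, huv, fun p => ?_⟩
  by_contra hb
  exact hsep ⟨p.induce {x | x ≠ b} fun x hx hxb => hb (hxb ▸ hx)⟩

lemma nodeAdh_emb (v : V) : E.toTreeCutDecomp.nodeAdh (E.emb v) = ∅ := by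
  classical
  have := E.fintypeβ
  have hdeg : E.T.degree (E.emb v) = 1 := by
    rw [← card_neighborSet_eq_degree, ← Nat.card_eq_fintype_card, Nat.card_coe_set_eq]
    exact E.emb_leaf v
  refine Set.eq_empty_of_forall_notMem ?_
  rintro e ⟨u, w, rfl, -, hu, hw, hsep⟩
  exact hsep
    ((E.isTree.connected.induce_compl_singleton_of_degree_eq_one hdeg).preconnected _ _)

lemma ncard_bag_add_ncard_nodeAdh_le_congestion [Finite V] [Nontrivial V] (hG : G.Connected)
    (b : E.β) :
    (E.toTreeCutDecomp.loc ⁻¹' {b}).ncard + (E.toTreeCutDecomp.nodeAdh b).ncard ≤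
      E.congestion := by
  refine le_trans ?_ (E.ncard_edgesThrough_le_congestion b)
  by_cases hb : ∃ v, E.emb v = b
  · obtain ⟨v, rfl⟩ := hb
    have hbag : E.toTreeCutDecomp.loc ⁻¹' {E.emb v} = {v} := by
      ext w
      exact E.emb.injective.eq_iff
    rw [nodeAdh_emb, hbag, Set.ncard_singleton, Set.ncard_empty]
    obtain ⟨w, hw⟩ := hG.preconnected.exists_adj_of_nontrivial v
    exact (Set.ncard_pos (Set.toFinite _)).2 ⟨s(v, w), v, w, rfl, hw, fun p => p.start_mem_support⟩
  · have hbag : E.toTreeCutDecomp.loc ⁻¹' {b} = ∅ :=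
      Set.eq_empty_of_forall_notMem fun v hv => hb ⟨v, hv⟩
    rw [hbag, Set.ncard_empty, zero_add]
    exact Set.ncard_le_ncard (E.nodeAdh_subset_edgesThrough b) (Set.toFinite _)

lemma width_toTreeCutDecomp_le_congestion [Finite V] [Nontrivial V] (hG : G.Connected) :
    E.toTreeCutDecomp.width ≤ E.congestion := by
  obtain ⟨v⟩ := hG.nonempty
  refine csSup_le ⟨_, Or.inr ⟨E.emb v, rfl⟩⟩ ?_
  rintro _ (⟨a, b, -, rfl⟩ | ⟨b, rfl⟩)
  · exact (Set.ncard_le_ncard (E.linkAdh_subset_edgesThrough a b) (Set.toFinite _)).trans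
      (E.ncard_edgesThrough_le_congestion a)
  · exact E.ncard_bag_add_ncard_nodeAdh_le_congestion hG b

end SubcubicTreeEmbedding

/-- For every finite connected simple graph `G` with at least `3`
vertices, `scw(G) ≤ vcon(G)`. -/
theorem screewidth_le_vertexCongestion {V : Type u} [Fintype V] (G : SimpleGraph V)
    (hconn : G.Connected) (hcard : 3 ≤ Fintype.card V) :
    screewidth G ≤ vertexCongestion G := by
  have : Nontrivial V := Fintype.one_lt_card_iff_nontrivial.1 (by omega)
  obtain ⟨E₀⟩ := nonempty_subcubicTreeEmbedding G
  obtain ⟨E, hE⟩ : ∃ E : SubcubicTreeEmbedding G, E.congestion = vertexCongestion G :=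
    Nat.sInf_mem (s := {n | ∃ E : SubcubicTreeEmbedding G, E.congestion = n}) ⟨_, E₀, rfl⟩
  rw [← hE]
  exact le_trans (Nat.sInf_le ⟨E.toTreeCutDecomp, rfl⟩)
    (E.width_toTreeCutDecomp_le_congestion hconn)
end
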